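/- arXiv:math/9803090 — 5 statements merged into one kernel-verified Lean document; each statement's English description precedes it below -/
import Mathlib

section
/- The linear map sending the j-th standard basis vector e_j of ℂ^{2m} to γ_j satisfies γ(x)² = Q_k(x)·I for every x (where γ(x) := Σ_j x_j γ_j), hence induces a ℂ-algebra homomorphism from the Clifford algebra of the quadratic form Q_k on ℂ^{2m} to the matrix algebra M(2^m, ℂ); this homomorphism is bijective, i.e. the complexified Clifford algebra Cliff^ℂ_{2m,k} is isomorphic as a ℂ-algebra to M(2^m, ℂ) via the explicit map γ. -/
open Matrix Complex

noncomputable section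

/-- The 2×2 matrix `U = [[i,0],[0,-i]]`. -/
def matU : Matrix (Fin 2) (Fin 2) ℂ := !![Complex.I, 0; 0, -Complex.I]

/-- The 2×2 matrix `V = [[0,i],[i,0]]`. -/
def matV : Matrix (Fin 2) (Fin 2) ℂ := !![0, Complex.I; Complex.I, 0]

/-- The 2×2 identity matrix `E`. -/
def matE : Matrix (Fin 2) (Fin 2) ℂ := !![1, 0; 0, 1]

/-- The 2×2 matrix `T = [[0,-i],[i,0]]`. -/
def matT : Matrix (Fin 2) (Fin 2) ℂ := !![0, -Complex.I; Complex.I, 0]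

/-- `epsC k j = ε_j`:  `-1` for `j ≤ k` and `1` for `j > k` (1-based index `j`). -/
def epsC (k j : ℕ) : ℂ := if j ≤ k then -1 else 1

/-- `tauC k j = τ_j`:  `i` for `j ≤ k` and `1` for `j > k` (1-based index `j`). -/
def tauC (k j : ℕ) : ℂ := if j ≤ k then Complex.I else 1

/-- The 2×2 factor sitting in slot `α` (0-based, slot `0` is the leftmost tensor factor)
of the iterated Kronecker product defining `γ_l` (1-based `l`): for `l = 2j-1` resp.
`l = 2j` this product is `E^{⊗(m-j)} ⊗ U ⊗ T^{⊗(j-1)}` resp. `E^{⊗(m-j)} ⊗ V ⊗ T^{⊗(j-1)}`. -/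
def gammaFac (m l : ℕ) (α : Fin m) : Matrix (Fin 2) (Fin 2) ℂ :=
  if (α : ℕ) < m - (l + 1) / 2 then matE
  else if (α : ℕ) = m - (l + 1) / 2 then (if l % 2 = 1 then matU else matV) else matT

/-- `γ_l = τ_l · (E^{⊗(m-j)} ⊗ U/V ⊗ T^{⊗(j-1)})` as a `2^m × 2^m` matrix whose rows and
columns are indexed by `Fin m → Fin 2` (identifying `ℂ^{2^m}` with the `m`-fold Kronecker
power of `ℂ²`, slot `0` being the leftmost factor). -/
def gammaM (m k l : ℕ) : Matrix (Fin m → Fin 2) (Fin m → Fin 2) ℂ :=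
  Matrix.of fun i i' => tauC k l * ∏ α, gammaFac m l α (i α) (i' α)

/-- `u(δ) = (1/√2)(1, -δ i) ∈ ℂ²`. -/
def uVec (δ : ℤ) : Fin 2 → ℂ :=
  fun t => if t = 0 then (Real.sqrt 2 : ℂ)⁻¹ else -(δ : ℂ) * Complex.I * (Real.sqrt 2 : ℂ)⁻¹

/-- `u(δ₁,…,δ_m) = u(δ₁) ⊗ ⋯ ⊗ u(δ_m) ∈ ℂ^{2^m}`. -/
def uProd (m : ℕ) (δ : Fin m → ℤ) : (Fin m → Fin 2) → ℂ :=
  fun i => ∏ α, uVec (δ α) (i α)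

/-- The standard Hermitian inner product, conjugate-linear in the second argument. -/
def hermIP {ι : Type*} [Fintype ι] (x y : ι → ℂ) : ℂ :=
  ∑ i, x i * (starRingEnd ℂ) (y i)

/-- The product `γ_1 γ_2 ⋯ γ_{2m}`. -/
def gammaVol (m k : ℕ) : Matrix (Fin m → Fin 2) (Fin m → Fin 2) ℂ :=
  ((List.range (2 * m)).map fun l => gammaM m k (l + 1)).prod

/-- The eigenspace `Δ^ε_{2m,k}` of `γ_1 γ_2 ⋯ γ_{2m}` for the eigenvalue `ε · i^{m+k}`. -/
def DeltaSp (m k : ℕ) (ε : ℤ) : Submodule ℂ ((Fin m → Fin 2) → ℂ) :=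
  Module.End.eigenspace (Matrix.toLin' (gammaVol m k)) ((ε : ℂ) * Complex.I ^ (m + k))

/-- The indefinite inner product `⟨u,v⟩ := (γ_1 u, v)` (here `k = 1`). -/
def indefIP (m : ℕ) (u v : (Fin m → Fin 2) → ℂ) : ℂ :=
  hermIP ((gammaM m 1 1).mulVec u) v

/-- The canonical vector `V_u` of a spinor `u`, with components
`(V_u)_j = -ε_j ⟨γ_j u, u⟩` (here `k = 1`). -/
def canV (m : ℕ) (u : (Fin m → Fin 2) → ℂ) : Fin (2 * m) → ℂ :=
  fun j => -(epsC 1 ((j : ℕ) + 1)) * indefIP m ((gammaM m 1 ((j : ℕ) + 1)).mulVec u) u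

/-- `x ⊗ v` under the identification `ℂ^{2^{n+1}} = ℂ^{2^n} ⊗ ℂ²` (the `ℂ²` factor last). -/
def tensP (n : ℕ) (x : (Fin n → Fin 2) → ℂ) (v : Fin 2 → ℂ) : (Fin (n + 1) → Fin 2) → ℂ :=
  fun i => x (Fin.init i) * v (i (Fin.last n))

/-- `Ω₀ = Σ_α γ'_{2α-1} γ'_{2α}` (here `k = 0`). -/
def OmegaZero (n : ℕ) : Matrix (Fin n → Fin 2) (Fin n → Fin 2) ℂ :=
  ∑ α : Fin n, gammaM n 0 (2 * (α : ℕ) + 1) * gammaM n 0 (2 * (α : ℕ) + 2)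

end
noncomputable section

/-- The linear map `ℂ^{2m} → M(2^m, ℂ)` sending `x` to `γ(x) = Σ_j x_j γ_j`. -/
def gammaLin (m k : ℕ) : (Fin (2 * m) → ℂ) →ₗ[ℂ] Matrix (Fin m → Fin 2) (Fin m → Fin 2) ℂ :=
  ∑ j : Fin (2 * m), (LinearMap.proj j).smulRight (gammaM m k ((j : ℕ) + 1))

/-- The quadratic form `Q_k(x) = Σ_{j ≤ k} x_j² - Σ_{j > k} x_j²` on `ℂ^{2m}`,
so that `Q_k(e_j) = -ε_j`. -/
def Qform (m k : ℕ) : QuadraticForm ℂ (Fin (2 * m) → ℂ) :=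
  QuadraticMap.weightedSumSquares ℂ fun j : Fin (2 * m) => -(epsC k ((j : ℕ) + 1))

end

section PiKronecker

variable {ι n R : Type*} [Fintype ι] [CommRing R]

/-- The Kronecker product of a finite family of matrices, with rows and columns indexed by
functions. -/
def piKronecker (A : ι → Matrix n n R) : Matrix (ι → n) (ι → n) R :=
  Matrix.of fun i i' => ∏ α, A α (i α) (i' α)

theorem piKronecker_apply (A : ι → Matrix n n R) (i i' : ι → n) :
    piKronecker A i i' = ∏ α, A α (i α) (i' α) := rfl

theorem piKronecker_one [DecidableEq n] :
    piKronecker (1 : ι → Matrix n n R) = 1 := by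
  ext i i'
  simp only [piKronecker_apply, Pi.one_apply, Matrix.one_apply, Finset.prod_boole,
    Finset.mem_univ, true_imp_iff, funext_iff]

theorem piKronecker_single [DecidableEq n] (i i' : ι → n) :
    piKronecker (fun α => Matrix.single (i α) (i' α) (1 : R)) = Matrix.single i i' 1 := by
  ext j j'
  simp only [piKronecker_apply, Matrix.single_apply, Finset.prod_boole,
    Finset.mem_univ, true_imp_iff, funext_iff, forall_and]

variable [DecidableEq ι]

theorem piKronecker_mul [Fintype n] (A B : ι → Matrix n n R) :
    piKronecker A * piKronecker B = piKronecker (A * B) := by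
  ext i i'
  simp only [Matrix.mul_apply, piKronecker_apply, Pi.mul_apply, ← Finset.prod_mul_distrib]
  rw [Finset.prod_univ_sum, Fintype.piFinset_univ]

theorem piKronecker_update_apply (A : ι → Matrix n n R) (β : ι) (X : Matrix n n R)
    (i i' : ι → n) :
    piKronecker (Function.update A β X) i i' =
      X (i β) (i' β) * ∏ α ∈ Finset.univ.erase β, A α (i α) (i' α) := by
  rw [piKronecker_apply, ← Finset.mul_prod_erase _ _ (Finset.mem_univ β), Function.update_self]
  congr 1
  refine Finset.prod_congr rfl fun α hα => ?_
  rw [Function.update_of_ne (Finset.ne_of_mem_erase hα)]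

/-- Kronecker products anticommute if their factors commute in all slots but one, in which they
anticommute. -/
theorem piKronecker_anticomm [Fintype n] (A B : ι → Matrix n n R) (β : ι)
    (hβ : A β * B β = -(B β * A β)) (h : ∀ α ≠ β, A α * B α = B α * A α) :
    piKronecker A * piKronecker B + piKronecker B * piKronecker A = 0 := by
  have hAB : A * B = Function.update (B * A) β (-(B β * A β)) := by
    ext1 α
    rcases eq_or_ne α β with rfl | hα
    · simpa using hβ
    · simpa [hα] using h α hα
  rw [piKronecker_mul, piKronecker_mul, hAB]
  nth_rewrite 2 [← Function.update_eq_self β (B * A)]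
  ext i i'
  rw [Matrix.add_apply, piKronecker_update_apply, piKronecker_update_apply]
  simp

end PiKronecker

theorem matE_eq_one : matE = 1 := Matrix.one_fin_two.symm

theorem matU_mul_matU : matU * matU = -1 := by
  ext a b; fin_cases a <;> fin_cases b <;> simp [matU]

theorem matV_mul_matV : matV * matV = -1 := by
  ext a b; fin_cases a <;> fin_cases b <;> simp [matV]

theorem matT_mul_matT : matT * matT = 1 := by
  ext a b; fin_cases a <;> fin_cases b <;> simp [matT]

theorem matU_mul_matV : matU * matV = -(matV * matU) := by
  ext a b; fin_cases a <;> fin_cases b <;> simp [matU, matV]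

theorem matU_mul_matT : matU * matT = -(matT * matU) := by
  ext a b; fin_cases a <;> fin_cases b <;> simp [matU, matT]

theorem matV_mul_matT : matV * matT = -(matT * matV) := by
  ext a b; fin_cases a <;> fin_cases b <;> simp [matV, matT]

/-- The matrices `1`, `U`, `V` and `UV` span the algebra of complex 2×2 matrices. -/
theorem exists_eq_smul_one_add_matU_matV (X : Matrix (Fin 2) (Fin 2) ℂ) :
    ∃ a b c d : ℂ, X = a • 1 + b • matU + c • matV + d • (matU * matV) := by
  refine ⟨(X 0 0 + X 1 1) / 2, -I * (X 0 0 - X 1 1) / 2, -I * (X 0 1 + X 1 0) / 2,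
    (X 1 0 - X 0 1) / 2, ?_⟩
  ext a b
  fin_cases a <;> fin_cases b <;> simp [matU, matV] <;> ring_nf <;> simp <;> ring

theorem tauC_mul_tauC (k l : ℕ) : tauC k l * tauC k l = epsC k l := by
  unfold tauC epsC; split_ifs <;> simp

theorem tauC_ne_zero (k l : ℕ) : tauC k l ≠ 0 := by
  unfold tauC; split_ifs <;> simp

theorem gammaM_eq_smul_piKronecker (m k l : ℕ) :
    gammaM m k l = tauC k l • piKronecker (gammaFac m l) := rfl

theorem gammaM_mul_self {m k l : ℕ} (h1 : 1 ≤ l) (h2 : l ≤ 2 * m) :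
    gammaM m k l * gammaM m k l = (-epsC k l) • 1 := by
  let β : Fin m := ⟨m - (l + 1) / 2, by omega⟩
  have hβ : gammaFac m l * gammaFac m l =
      Function.update (1 : Fin m → Matrix (Fin 2) (Fin 2) ℂ) β (-1) := by
    ext1 α
    rcases lt_trichotomy α β with h | h | h
    · have h' : (α : ℕ) < m - (l + 1) / 2 := h
      simp [gammaFac, h', h.ne, matE_eq_one]
    · subst h
      simp only [gammaFac, β, Pi.mul_apply, lt_irrefl, if_true, if_false, Function.update_self]
      split_ifs
      exacts [matU_mul_matU, matV_mul_matV]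
    · have h' : m - (l + 1) / 2 < (α : ℕ) := h
      simp [gammaFac, h'.not_gt, h'.ne', h.ne', matT_mul_matT]
  have hK : piKronecker (Function.update (1 : Fin m → Matrix (Fin 2) (Fin 2) ℂ) β (-1)) = -1 := by
    rw [← piKronecker_one]
    nth_rewrite 2 [← Function.update_eq_self β (1 : Fin m → Matrix (Fin 2) (Fin 2) ℂ)]
    ext i i'
    rw [Matrix.neg_apply, piKronecker_update_apply, piKronecker_update_apply]
    simp
  rw [gammaM_eq_smul_piKronecker, smul_mul_smul_comm, piKronecker_mul, hβ, hK, tauC_mul_tauC]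
  simp

theorem gammaM_anticomm_of_lt {m k l l' : ℕ} (h1 : 1 ≤ l) (hlt : l < l') (h2 : l' ≤ 2 * m) :
    gammaM m k l * gammaM m k l' + gammaM m k l' * gammaM m k l = 0 := by
  have key := piKronecker_anticomm (gammaFac m l) (gammaFac m l') ⟨m - (l + 1) / 2, by omega⟩
    (by
      rcases eq_or_lt_of_le (show (l + 1) / 2 ≤ (l' + 1) / 2 by omega) with h | h
      · have hl : l % 2 = 1 := by omega
        have hl' : ¬ l' % 2 = 1 := by omega
        simpa [gammaFac, h, hl, hl'] using matU_mul_matV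
      · have h3 : ¬ m - (l + 1) / 2 < m - (l' + 1) / 2 := by omega
        have h4 : ¬ m - (l + 1) / 2 = m - (l' + 1) / 2 := by omega
        simp only [gammaFac, h3, h4, lt_irrefl, if_true, if_false]
        split_ifs
        exacts [matU_mul_matT, matV_mul_matT])
    (by
      intro α hα
      have hα' : (α : ℕ) ≠ m - (l + 1) / 2 := fun h => hα (Fin.ext h)
      by_cases h : (α : ℕ) < m - (l + 1) / 2
      · simp [gammaFac, h, matE_eq_one]
      · have h3 : ¬ (α : ℕ) < m - (l' + 1) / 2 := by omega
        have h4 : ¬ (α : ℕ) = m - (l' + 1) / 2 := by omega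
        simp [gammaFac, h, h3, h4, hα'])
  rw [gammaM_eq_smul_piKronecker, gammaM_eq_smul_piKronecker, smul_mul_smul_comm,
    smul_mul_smul_comm, mul_comm (tauC k l'), ← smul_add, key, smul_zero]

theorem gammaM_anticomm {m k l l' : ℕ} (h1 : 1 ≤ l) (h1' : 1 ≤ l') (hne : l ≠ l')
    (h2 : l ≤ 2 * m) (h2' : l' ≤ 2 * m) :
    gammaM m k l * gammaM m k l' + gammaM m k l' * gammaM m k l = 0 := by
  rcases hne.lt_or_gt with h | h
  · exact gammaM_anticomm_of_lt h1 h h2'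
  · rw [add_comm]
    exact gammaM_anticomm_of_lt h1' h h2

theorem gammaLin_apply (m k : ℕ) (x : Fin (2 * m) → ℂ) :
    gammaLin m k x = ∑ j : Fin (2 * m), x j • gammaM m k ((j : ℕ) + 1) := by
  simp [gammaLin]

theorem gammaLin_single (m k : ℕ) (j : Fin (2 * m)) :
    gammaLin m k (Pi.single j 1) = gammaM m k ((j : ℕ) + 1) := by
  simp [gammaLin_apply, Pi.single_apply]

theorem gammaLin_mul_self (m k : ℕ) (x : Fin (2 * m) → ℂ) :
    gammaLin m k x * gammaLin m k x =
      algebraMap ℂ (Matrix (Fin m → Fin 2) (Fin m → Fin 2) ℂ) (Qform m k x) := by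
  have hsq : gammaLin m k x * gammaLin m k x = ∑ i : Fin (2 * m), ∑ j : Fin (2 * m),
      (x i * x j) • (gammaM m k (i + 1) * gammaM m k (j + 1)) := by
    simp only [gammaLin_apply, Finset.sum_mul_sum, smul_mul_smul_comm]
  have hswap : gammaLin m k x * gammaLin m k x = ∑ i : Fin (2 * m), ∑ j : Fin (2 * m),
      (x i * x j) • (gammaM m k (j + 1) * gammaM m k (i + 1)) := by
    rw [hsq, Finset.sum_comm]
    simp only [mul_comm]
  have hdiag (i : Fin (2 * m)) : ∑ j : Fin (2 * m), (x i * x j) •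
      (gammaM m k (i + 1) * gammaM m k (j + 1) + gammaM m k (j + 1) * gammaM m k (i + 1)) =
      (2 : ℂ) • (-epsC k (i + 1) * (x i * x i)) • 1 := by
    rw [Finset.sum_eq_single i]
    · rw [gammaM_mul_self (by omega) (by omega), ← two_smul ℂ, smul_comm, smul_smul (x i * x i),
        mul_comm (x i * x i)]
    · intro j _ hj
      rw [gammaM_anticomm (by omega) (by omega) (by omega) (by omega) (by omega), smul_zero]
    · simp
  have h2 : (2 : ℂ) • (gammaLin m k x * gammaLin m k x) =
      (2 : ℂ) • algebraMap ℂ (Matrix (Fin m → Fin 2) (Fin m → Fin 2) ℂ) (Qform m k x) := by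
    rw [two_smul]
    nth_rewrite 1 [hsq]
    rw [hswap]
    simp only [← Finset.sum_add_distrib, ← smul_add, hdiag]
    rw [← Finset.smul_sum, ← Finset.sum_smul, Algebra.algebraMap_eq_smul_one, Qform,
      QuadraticMap.weightedSumSquares_apply]
    simp only [smul_eq_mul]
  exact smul_right_injective _ two_ne_zero h2

/-- A subalgebra containing all `γ_l` contains every Kronecker product supported in the last
`n` slots. -/
theorem piKronecker_mem_of_gammaM_mem {m k : ℕ}
    {S : Subalgebra ℂ (Matrix (Fin m → Fin 2) (Fin m → Fin 2) ℂ)}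
    (hS : ∀ j : Fin (2 * m), gammaM m k ((j : ℕ) + 1) ∈ S) {n : ℕ} (hn : n ≤ m)
    (A : Fin m → Matrix (Fin 2) (Fin 2) ℂ) (hA : ∀ α : Fin m, (α : ℕ) < m - n → A α = 1) :
    piKronecker A ∈ S := by
  induction n generalizing A with
  | zero =>
    obtain rfl : A = 1 := funext fun α => hA α (by omega)
    rw [piKronecker_one]
    exact S.one_mem
  | succ n ih =>
    let β : Fin m := ⟨m - (n + 1), by omega⟩
    have hfac (l : ℕ) (hl1 : 1 ≤ l) (hl2 : l ≤ 2 * m) : piKronecker (gammaFac m l) ∈ S := by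
      have h := S.smul_mem (hS ⟨l - 1, by omega⟩) (tauC k l)⁻¹
      simp only [Nat.sub_add_cancel hl1] at h
      rwa [gammaM_eq_smul_piKronecker, inv_smul_smul₀ (tauC_ne_zero k l)] at h
    have hmul (l : ℕ) (hl : (l + 1) / 2 = n + 1) (B : Fin m → Matrix (Fin 2) (Fin 2) ℂ)
        (hB : ∀ α < β, B α = 1) :
        piKronecker (Function.update B β (gammaFac m l β)) ∈ S := by
      have hP := ih (by omega) (fun α => if α ≤ β then 1 else B α * matT) fun α hα => by
        rw [if_pos]
        change (α : ℕ) ≤ m - (n + 1)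
        omega
      have h := S.mul_mem hP (hfac l (by omega) (by omega))
      rw [piKronecker_mul] at h
      convert h using 2
      ext1 α
      rcases lt_trichotomy α β with hα | rfl | hα
      · have h' : (α : ℕ) < m - (n + 1) := hα
        simp [hα.ne, hα.le, gammaFac, hl, h', hB α hα, matE_eq_one]
      · simp
      · have h' : m - (n + 1) < (α : ℕ) := hα
        simp [hα.ne', hα.not_ge, gammaFac, hl, h'.not_gt, h'.ne', mul_assoc, matT_mul_matT]
    have hU (B : Fin m → Matrix (Fin 2) (Fin 2) ℂ) (hB : ∀ α < β, B α = 1) :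
        piKronecker (Function.update B β matU) ∈ S := by
      have h := hmul (2 * n + 1) (by omega) B hB
      have e : gammaFac m (2 * n + 1) β = matU := by
        simp [gammaFac, β, show (2 * n + 1 + 1) / 2 = n + 1 by omega]
      rwa [e] at h
    have hV (B : Fin m → Matrix (Fin 2) (Fin 2) ℂ) (hB : ∀ α < β, B α = 1) :
        piKronecker (Function.update B β matV) ∈ S := by
      have h := hmul (2 * n + 2) (by omega) B hB
      have e : gammaFac m (2 * n + 2) β = matV := by
        simp [gammaFac, β, show (2 * n + 2 + 1) / 2 = n + 1 by omega]
      rwa [e] at h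
    have h1 : piKronecker (Function.update A β 1) ∈ S := by
      refine ih (by omega) _ fun α hα => ?_
      rcases eq_or_ne α β with rfl | hne
      · simp
      · have : (α : ℕ) ≠ m - (n + 1) := fun h => hne (Fin.ext h)
        rw [Function.update_of_ne hne, hA α (by omega)]
    have hUV : piKronecker (Function.update A β (matU * matV)) ∈ S := by
      have h := S.mul_mem (hU 1 fun _ _ => rfl) (hV A fun α hα => hA α hα)
      rwa [piKronecker_mul, ← Function.update_mul, one_mul] at h
    obtain ⟨a, b, c, d, hX⟩ := exists_eq_smul_one_add_matU_matV (A β)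
    have hsum : piKronecker A = a • piKronecker (Function.update A β 1) +
        b • piKronecker (Function.update A β matU) + c • piKronecker (Function.update A β matV) +
        d • piKronecker (Function.update A β (matU * matV)) := by
      nth_rewrite 1 [← Function.update_eq_self β A]
      rw [hX]
      ext i i'
      simp only [Matrix.add_apply, Matrix.smul_apply, piKronecker_update_apply, smul_eq_mul]
      ring
    rw [hsum]
    exact S.add_mem (S.add_mem (S.add_mem (S.smul_mem h1 a)
      (S.smul_mem (hU A fun α hα => hA α hα) b)) (S.smul_mem (hV A fun α hα => hA α hα) c))
      (S.smul_mem hUV d)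

theorem adjoin_range_gammaLin (m k : ℕ) :
    Algebra.adjoin ℂ (Set.range (gammaLin m k)) = ⊤ := by
  rw [eq_top_iff]
  intro M _
  rw [Matrix.matrix_eq_sum_single M]
  refine Subalgebra.sum_mem _ fun i _ => Subalgebra.sum_mem _ fun i' _ => ?_
  have hentry : Matrix.single i i' (M i i') =
      M i i' • piKronecker fun α => Matrix.single (i α) (i' α) (1 : ℂ) := by
    rw [piKronecker_single, Matrix.smul_single, smul_eq_mul, mul_one]
  rw [hentry]
  refine Subalgebra.smul_mem _ (piKronecker_mem_of_gammaM_mem (k := k) (fun j => ?_) le_rfl _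
    fun α hα => by omega) _
  exact Algebra.subset_adjoin ⟨Pi.single j 1, gammaLin_single m k j⟩

theorem CliffordAlgebra.finrank_eq_two_pow {K M : Type*} [Field K] [Invertible (2 : K)]
    [AddCommGroup M] [Module K M] {n : ℕ} (b : Module.Basis (Fin n) K M)
    (Q : QuadraticForm K M) : Module.finrank K (CliffordAlgebra Q) = 2 ^ n := by
  rw [(CliffordAlgebra.equivExterior Q).finrank_eq,
    Module.finrank_eq_card_basis b.ExteriorAlgebra, Fintype.card_finset, Fintype.card_fin]

theorem CliffordAlgebra.finiteDimensional_of_basis {K M : Type*} [Field K] [Invertible (2 : K)]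
    [AddCommGroup M] [Module K M] {n : ℕ} (b : Module.Basis (Fin n) K M)
    (Q : QuadraticForm K M) : FiniteDimensional K (CliffordAlgebra Q) :=
  Module.Finite.of_basis (b.ExteriorAlgebra.map (CliffordAlgebra.equivExterior Q).symm)

/-- the map `e_j ↦ γ_j` satisfies `γ(x)² = Q_k(x)·I`, hence induces a
ℂ-algebra homomorphism `Cliff^ℂ_{2m,k} = CliffordAlgebra Q_k → M(2^m, ℂ)`, and this
homomorphism is bijective. -/
theorem cliffordAlgebra_iso_matrix (m k : ℕ) (hm : 1 ≤ m) (hk : k ≤ 2 * m) :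
    (∀ j : Fin (2 * m), gammaLin m k (Pi.single j 1) = gammaM m k ((j : ℕ) + 1)) ∧
    ∃ h : ∀ x : Fin (2 * m) → ℂ,
        gammaLin m k x * gammaLin m k x =
          algebraMap ℂ (Matrix (Fin m → Fin 2) (Fin m → Fin 2) ℂ) (Qform m k x),
      Function.Bijective (CliffordAlgebra.lift (Qform m k) ⟨gammaLin m k, h⟩) := by
  refine ⟨gammaLin_single m k, gammaLin_mul_self m k, ?_⟩
  have hsurj : Function.Surjective
      (CliffordAlgebra.lift (Qform m k) ⟨gammaLin m k, gammaLin_mul_self m k⟩) := by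
    rw [← AlgHom.range_eq_top, CliffordAlgebra.range_lift, adjoin_range_gammaLin]
  let b := Pi.basisFun ℂ (Fin (2 * m))
  have : Invertible (2 : ℂ) := invertibleOfNonzero two_ne_zero
  have := CliffordAlgebra.finiteDimensional_of_basis b (Qform m k)
  have hrank : Module.finrank ℂ (CliffordAlgebra (Qform m k)) =
      Module.finrank ℂ (Matrix (Fin m → Fin 2) (Fin m → Fin 2) ℂ) := by
    rw [CliffordAlgebra.finrank_eq_two_pow b, Module.finrank_matrix]
    simp [two_mul, pow_add]
  exact ⟨(LinearMap.injective_iff_surjective_of_finrank_eq_finrank hrank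
    (f := (CliffordAlgebra.lift (Qform m k)
      ⟨gammaLin m k, gammaLin_mul_self m k⟩).toLinearMap)).2 hsurj, hsurj⟩
end

section
/- Let m ∈ {1, 2, 3} and k = 1. For every sign ε = ±1 and every u in the half-spinor space Δ^ε_{2m,1}, the canonical vector V_u satisfies γ(V_u) · u = 0 (where γ(V_u) := Σ_j (V_u)_j γ_j); in particular V_u is isotropic: −(V_u)_1² + Σ_{j=2}^{2m} (V_u)_j² = 0. -/
open Matrix Complex

theorem sum_fin_succ_arrow {α M : Type*} [Fintype α] [AddCommMonoid M] {n : ℕ}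
    (f : (Fin (n + 1) → α) → M) : ∑ i, f i = ∑ a, ∑ i, f (Matrix.vecCons a i) := by
  rw [← (Fin.consEquiv fun _ => α).sum_comp, Fintype.sum_prod_type]
  rfl

theorem sum_fin_one_arrow {α M : Type*} [Fintype α] [AddCommMonoid M] (f : (Fin 1 → α) → M) :
    ∑ i, f i = ∑ a, f ![a] := by
  simp only [sum_fin_succ_arrow, Fintype.sum_unique]
  congr!

theorem forall_fin_one_arrow {α : Type*} {p : (Fin 1 → α) → Prop} :
    (∀ i, p i) ↔ ∀ a, p ![a] := by
  simp only [Fin.forall_fin_succ_pi, Fin.forall_fin_zero_pi]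
  rfl

theorem gammaVol_one_mulVec (u : (Fin 1 → Fin 2) → ℂ) :
    (gammaVol 1 1).mulVec u =
      (gammaM 1 1 1).mulVec ((gammaM 1 1 2).mulVec u) := by
  simp [gammaVol, List.range_succ, Matrix.mulVec_mulVec]

theorem gammaM_one_mulVec (l : ℕ) (w : (Fin 1 → Fin 2) → ℂ) (a : Fin 2) :
    (gammaM 1 1 l).mulVec w ![a] =
      tauC 1 l * ∑ a', gammaFac 1 l 0 a a' *
        w ![a'] := by
  simp only [Matrix.mulVec, dotProduct, gammaM, Matrix.of_apply, sum_fin_one_arrow,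
    Finset.univ_unique, Finset.prod_singleton, Fin.default_eq_zero, Finset.mul_sum]
  simp [mul_assoc]

theorem gammaM_one_one_mulVec (w : (Fin 1 → Fin 2) → ℂ) (a : Fin 2) :
    (gammaM 1 1 1).mulVec w ![a] = -![1, -1] a * w ![a] := by
  rw [gammaM_one_mulVec]
  fin_cases a <;>
    simp [tauC, gammaFac, matU, ← mul_assoc]

theorem gammaM_one_two_mulVec (w : (Fin 1 → Fin 2) → ℂ) (a : Fin 2) :
    (gammaM 1 1 2).mulVec w ![a] = I * w ![1 - a] := by
  rw [gammaM_one_mulVec]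
  fin_cases a <;>
    simp [tauC, gammaFac, matV, ← mul_assoc]

theorem apply_flip_of_mem_DeltaSp_one {ε : ℤ} {u : (Fin 1 → Fin 2) → ℂ}
    (hu : u ∈ DeltaSp 1 1 ε) (a : Fin 2) :
    u ![1 - a] = -I * (![1, -1] a) * ε * u ![a] := by
  rw [DeltaSp, Module.End.mem_eigenspace_iff, Matrix.toLin'_apply, gammaVol_one_mulVec] at hu
  have := congrFun hu ![a]
  simp only [gammaM_one_one_mulVec, gammaM_one_two_mulVec] at this
  generalize u ![1 - a] = v at this ⊢
  fin_cases a <;>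
    simp [pow_succ, ← mul_assoc] at this ⊢ <;>
    first
    | linear_combination I * this + v * I_sq
    | linear_combination -I * this + v * I_sq

theorem canV_one (u : (Fin 1 → Fin 2) → ℂ) : canV 1 u = ![
    ∑ a, u ![a] * (starRingEnd ℂ) (u ![a]),
    ∑ a, I * ![1, -1] a * u ![1 - a] * (starRingEnd ℂ) (u ![a])] := by
  ext j
  fin_cases j <;>
    simp [-Matrix.mulVec_mulVec, canV, epsC, indefIP, hermIP, sum_fin_one_arrow,
      gammaM_one_one_mulVec, gammaM_one_two_mulVec]

theorem canV_isotropic_one {ε : ℤ} (hε : ε = 1 ∨ ε = -1)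
    {u : (Fin 1 → Fin 2) → ℂ} (hu : u ∈ DeltaSp 1 1 ε) :
    (∑ j : Fin (2 * 1), canV 1 u j • gammaM 1 1 ((j : ℕ) + 1)).mulVec u = 0 ∧
    ∑ j : Fin (2 * 1), (if (j : ℕ) = 0 then -1 else 1) * (canV 1 u j) ^ 2 = 0 := by
  have h_1 : u ![1] = _ := apply_flip_of_mem_DeltaSp_one hu 0
  have hε2 : (ε : ℂ) ^ 2 = 1 := by rcases hε with rfl | rfl <;> simp
  have hε3 : (ε : ℂ) ^ 3 = ε := by rw [pow_succ, hε2, one_mul]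
  have hε4 : (ε : ℂ) ^ 4 = 1 := by rw [pow_succ, hε3, ← sq, hε2]
  rw [canV_one]
  constructor
  · refine funext (forall_fin_one_arrow.mpr ?_)
    intro a
    simp only [Fin.sum_univ_succ (n := 1), Fin.sum_univ_one, Matrix.add_mulVec,
      Matrix.smul_mulVec, Pi.add_apply, Pi.smul_apply]
    simp [gammaM_one_one_mulVec, gammaM_one_two_mulVec]
    fin_cases a <;>
      simp [h_1] <;> ring_nf <;>
      simp [hε2, hε3] <;> ring
  · rw [Fin.sum_univ_succ (n := 1), Fin.sum_univ_one]
    simp [h_1]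
    ring_nf
    simp [hε2, hε4]
    ring

theorem sum_fin_two_arrow {α M : Type*} [Fintype α] [AddCommMonoid M] (f : (Fin 2 → α) → M) :
    ∑ i, f i = ∑ a, ∑ b, f ![a, b] := by
  simp only [sum_fin_succ_arrow, Fintype.sum_unique]
  congr!

theorem forall_fin_two_arrow {α : Type*} {p : (Fin 2 → α) → Prop} :
    (∀ i, p i) ↔ ∀ a b, p ![a, b] := by
  simp only [Fin.forall_fin_succ_pi, Fin.forall_fin_zero_pi]
  rfl

theorem gammaVol_two_mulVec (u : (Fin 2 → Fin 2) → ℂ) :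
    (gammaVol 2 1).mulVec u =
      (gammaM 2 1 1).mulVec ((gammaM 2 1 2).mulVec ((gammaM 2 1 3).mulVec ((gammaM 2 1 4).mulVec u))) := by
  simp [gammaVol, List.range_succ, Matrix.mulVec_mulVec]

theorem gammaM_two_mulVec (l : ℕ) (w : (Fin 2 → Fin 2) → ℂ) (a b : Fin 2) :
    (gammaM 2 1 l).mulVec w ![a, b] =
      tauC 1 l * ∑ a', gammaFac 2 l 0 a a' * ∑ b', gammaFac 2 l 1 b b' *
        w ![a', b'] := by
  simp only [Matrix.mulVec, dotProduct, gammaM, Matrix.of_apply, sum_fin_two_arrow,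
    Fin.prod_univ_two, Finset.mul_sum]
  simp [mul_assoc]

theorem gammaM_two_one_mulVec (w : (Fin 2 → Fin 2) → ℂ) (a b : Fin 2) :
    (gammaM 2 1 1).mulVec w ![a, b] = -![1, -1] b * w ![a, b] := by
  rw [gammaM_two_mulVec]
  fin_cases a <;> fin_cases b <;>
    simp [tauC, gammaFac, matE, matU, ← mul_assoc]

theorem gammaM_two_two_mulVec (w : (Fin 2 → Fin 2) → ℂ) (a b : Fin 2) :
    (gammaM 2 1 2).mulVec w ![a, b] = I * w ![a, 1 - b] := by
  rw [gammaM_two_mulVec]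
  fin_cases a <;> fin_cases b <;>
    simp [tauC, gammaFac, matE, matV, ← mul_assoc]

theorem gammaM_two_three_mulVec (w : (Fin 2 → Fin 2) → ℂ) (a b : Fin 2) :
    (gammaM 2 1 3).mulVec w ![a, b] = ![1, -1] a * ![1, -1] b * w ![a, 1 - b] := by
  rw [gammaM_two_mulVec]
  fin_cases a <;> fin_cases b <;>
    simp [tauC, gammaFac, matU, matT, ← mul_assoc]

theorem gammaM_two_four_mulVec (w : (Fin 2 → Fin 2) → ℂ) (a b : Fin 2) :
    (gammaM 2 1 4).mulVec w ![a, b] = ![1, -1] b * w ![1 - a, 1 - b] := by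
  rw [gammaM_two_mulVec]
  fin_cases a <;> fin_cases b <;>
    simp [tauC, gammaFac, matV, matT, ← mul_assoc]

theorem apply_flip_of_mem_DeltaSp_two {ε : ℤ} {u : (Fin 2 → Fin 2) → ℂ}
    (hu : u ∈ DeltaSp 2 1 ε) (a b : Fin 2) :
    u ![1 - a, 1 - b] = -(![1, -1] a * ![1, -1] b) * ε * u ![a, b] := by
  rw [DeltaSp, Module.End.mem_eigenspace_iff, Matrix.toLin'_apply, gammaVol_two_mulVec] at hu
  have := congrFun hu ![a, b]
  simp only [gammaM_two_one_mulVec, gammaM_two_two_mulVec, gammaM_two_three_mulVec,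
    gammaM_two_four_mulVec,
    sub_sub_cancel] at this
  generalize u ![1 - a, 1 - b] = v at this ⊢
  fin_cases a <;> fin_cases b <;>
    simp [pow_succ, ← mul_assoc] at this ⊢ <;>
    exact mul_left_cancel₀ I_ne_zero (by linear_combination this)

theorem canV_two (u : (Fin 2 → Fin 2) → ℂ) : canV 2 u = ![
    ∑ a, ∑ b, u ![a, b] * (starRingEnd ℂ) (u ![a, b]),
    ∑ a, ∑ b, I * ![1, -1] b * u ![a, 1 - b] * (starRingEnd ℂ) (u ![a, b]),
    ∑ a, ∑ b, ![1, -1] a * u ![a, 1 - b] * (starRingEnd ℂ) (u ![a, b]),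
    ∑ a, ∑ b, u ![1 - a, 1 - b] * (starRingEnd ℂ) (u ![a, b])] := by
  ext j
  fin_cases j <;>
    simp [-Matrix.mulVec_mulVec, canV, epsC, indefIP, hermIP, sum_fin_two_arrow,
      gammaM_two_one_mulVec, gammaM_two_two_mulVec, gammaM_two_three_mulVec,
      gammaM_two_four_mulVec] <;>
    ring

theorem canV_isotropic_two {ε : ℤ} (hε : ε = 1 ∨ ε = -1)
    {u : (Fin 2 → Fin 2) → ℂ} (hu : u ∈ DeltaSp 2 1 ε) :
    (∑ j : Fin (2 * 2), canV 2 u j • gammaM 2 1 ((j : ℕ) + 1)).mulVec u = 0 ∧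
    ∑ j : Fin (2 * 2), (if (j : ℕ) = 0 then -1 else 1) * (canV 2 u j) ^ 2 = 0 := by
  have h_11 : u ![1, 1] = _ := apply_flip_of_mem_DeltaSp_two hu 0 0
  have h_10 : u ![1, 0] = _ := apply_flip_of_mem_DeltaSp_two hu 0 1
  have hε2 : (ε : ℂ) ^ 2 = 1 := by rcases hε with rfl | rfl <;> simp
  have hε3 : (ε : ℂ) ^ 3 = ε := by rw [pow_succ, hε2, one_mul]
  have hε4 : (ε : ℂ) ^ 4 = 1 := by rw [pow_succ, hε3, ← sq, hε2]
  rw [canV_two]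
  constructor
  · refine funext (forall_fin_two_arrow.mpr ?_)
    intro a b
    simp only [Fin.sum_univ_succ (n := 3), Fin.sum_univ_three, Matrix.add_mulVec,
      Matrix.smul_mulVec, Pi.add_apply, Pi.smul_apply]
    simp [gammaM_two_one_mulVec, gammaM_two_two_mulVec, gammaM_two_three_mulVec,
      gammaM_two_four_mulVec]
    fin_cases a <;> fin_cases b <;>
      simp [h_11, h_10] <;> ring_nf <;>
      simp [hε2, hε3] <;> ring
  · rw [Fin.sum_univ_succ (n := 3), Fin.sum_univ_three]
    simp [h_11, h_10]
    ring_nf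
    simp [hε2, hε4]
    ring

theorem sum_fin_three_arrow {α M : Type*} [Fintype α] [AddCommMonoid M] (f : (Fin 3 → α) → M) :
    ∑ i, f i = ∑ a, ∑ b, ∑ c, f ![a, b, c] := by
  simp only [sum_fin_succ_arrow, Fintype.sum_unique]
  congr!

theorem forall_fin_three_arrow {α : Type*} {p : (Fin 3 → α) → Prop} :
    (∀ i, p i) ↔ ∀ a b c, p ![a, b, c] := by
  simp only [Fin.forall_fin_succ_pi, Fin.forall_fin_zero_pi]
  rfl

theorem gammaVol_three_mulVec (u : (Fin 3 → Fin 2) → ℂ) :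
    (gammaVol 3 1).mulVec u =
      (gammaM 3 1 1).mulVec ((gammaM 3 1 2).mulVec ((gammaM 3 1 3).mulVec (
        (gammaM 3 1 4).mulVec ((gammaM 3 1 5).mulVec ((gammaM 3 1 6).mulVec u))))) := by
  simp [gammaVol, List.range_succ, Matrix.mulVec_mulVec]

theorem gammaM_three_mulVec (l : ℕ) (w : (Fin 3 → Fin 2) → ℂ) (a b c : Fin 2) :
    (gammaM 3 1 l).mulVec w ![a, b, c] =
      tauC 1 l * ∑ a', gammaFac 3 l 0 a a' * ∑ b', gammaFac 3 l 1 b b' * ∑ c', gammaFac 3 l 2 c c' *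
        w ![a', b', c'] := by
  simp only [Matrix.mulVec, dotProduct, gammaM, Matrix.of_apply, sum_fin_three_arrow,
    Fin.prod_univ_three, Finset.mul_sum]
  simp [mul_assoc]

theorem gammaM_three_one_mulVec (w : (Fin 3 → Fin 2) → ℂ) (a b c : Fin 2) :
    (gammaM 3 1 1).mulVec w ![a, b, c] = -![1, -1] c * w ![a, b, c] := by
  rw [gammaM_three_mulVec]
  fin_cases a <;> fin_cases b <;> fin_cases c <;>
    simp [tauC, gammaFac, matE, matU, ← mul_assoc]

theorem gammaM_three_two_mulVec (w : (Fin 3 → Fin 2) → ℂ) (a b c : Fin 2) :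
    (gammaM 3 1 2).mulVec w ![a, b, c] = I * w ![a, b, 1 - c] := by
  rw [gammaM_three_mulVec]
  fin_cases a <;> fin_cases b <;> fin_cases c <;>
    simp [tauC, gammaFac, matE, matV, ← mul_assoc]

theorem gammaM_three_three_mulVec (w : (Fin 3 → Fin 2) → ℂ) (a b c : Fin 2) :
    (gammaM 3 1 3).mulVec w ![a, b, c] = ![1, -1] b * ![1, -1] c * w ![a, b, 1 - c] := by
  rw [gammaM_three_mulVec]
  fin_cases a <;> fin_cases b <;> fin_cases c <;>
    simp [tauC, gammaFac, matE, matU, matT, ← mul_assoc]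

theorem gammaM_three_four_mulVec (w : (Fin 3 → Fin 2) → ℂ) (a b c : Fin 2) :
    (gammaM 3 1 4).mulVec w ![a, b, c] = ![1, -1] c * w ![a, 1 - b, 1 - c] := by
  rw [gammaM_three_mulVec]
  fin_cases a <;> fin_cases b <;> fin_cases c <;>
    simp [tauC, gammaFac, matE, matV, matT, ← mul_assoc]

theorem gammaM_three_five_mulVec (w : (Fin 3 → Fin 2) → ℂ) (a b c : Fin 2) :
    (gammaM 3 1 5).mulVec w ![a, b, c] = -I * ![1, -1] a * ![1, -1] b * ![1, -1] c * w ![a, 1 - b, 1 - c] := by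
  rw [gammaM_three_mulVec]
  fin_cases a <;> fin_cases b <;> fin_cases c <;>
    simp [tauC, gammaFac, matU, matT, ← mul_assoc]

theorem gammaM_three_six_mulVec (w : (Fin 3 → Fin 2) → ℂ) (a b c : Fin 2) :
    (gammaM 3 1 6).mulVec w ![a, b, c] = -I * ![1, -1] b * ![1, -1] c * w ![1 - a, 1 - b, 1 - c] := by
  rw [gammaM_three_mulVec]
  fin_cases a <;> fin_cases b <;> fin_cases c <;>
    simp [tauC, gammaFac, matV, matT, ← mul_assoc]

theorem apply_flip_of_mem_DeltaSp_three {ε : ℤ} {u : (Fin 3 → Fin 2) → ℂ}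
    (hu : u ∈ DeltaSp 3 1 ε) (a b c : Fin 2) :
    u ![1 - a, 1 - b, 1 - c] = I * (![1, -1] a * ![1, -1] b * ![1, -1] c) * ε * u ![a, b, c] := by
  rw [DeltaSp, Module.End.mem_eigenspace_iff, Matrix.toLin'_apply, gammaVol_three_mulVec] at hu
  have := congrFun hu ![a, b, c]
  simp only [gammaM_three_one_mulVec, gammaM_three_two_mulVec, gammaM_three_three_mulVec,
    gammaM_three_four_mulVec, gammaM_three_five_mulVec, gammaM_three_six_mulVec,
    sub_sub_cancel] at this
  generalize u ![1 - a, 1 - b, 1 - c] = v at this ⊢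
  fin_cases a <;> fin_cases b <;> fin_cases c <;>
    simp [pow_succ, ← mul_assoc] at this ⊢ <;>
    first
    | linear_combination I * this + v * I_sq
    | linear_combination -I * this + v * I_sq

theorem canV_three (u : (Fin 3 → Fin 2) → ℂ) : canV 3 u = ![
    ∑ a, ∑ b, ∑ c, u ![a, b, c] * (starRingEnd ℂ) (u ![a, b, c]),
    ∑ a, ∑ b, ∑ c, I * ![1, -1] c * u ![a, b, 1 - c] * (starRingEnd ℂ) (u ![a, b, c]),
    ∑ a, ∑ b, ∑ c, ![1, -1] b * u ![a, b, 1 - c] * (starRingEnd ℂ) (u ![a, b, c]),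
    ∑ a, ∑ b, ∑ c, u ![a, 1 - b, 1 - c] * (starRingEnd ℂ) (u ![a, b, c]),
    ∑ a, ∑ b, ∑ c, -I * ![1, -1] a * ![1, -1] b * u ![a, 1 - b, 1 - c] * (starRingEnd ℂ) (u ![a, b, c]),
    ∑ a, ∑ b, ∑ c, -I * ![1, -1] b * u ![1 - a, 1 - b, 1 - c] * (starRingEnd ℂ) (u ![a, b, c])] := by
  ext j
  fin_cases j <;>
    simp [-Matrix.mulVec_mulVec, canV, epsC, indefIP, hermIP, sum_fin_three_arrow,
      gammaM_three_one_mulVec, gammaM_three_two_mulVec, gammaM_three_three_mulVec,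
      gammaM_three_four_mulVec, gammaM_three_five_mulVec, gammaM_three_six_mulVec] <;>
    ring

theorem canV_isotropic_three {ε : ℤ} (hε : ε = 1 ∨ ε = -1)
    {u : (Fin 3 → Fin 2) → ℂ} (hu : u ∈ DeltaSp 3 1 ε) :
    (∑ j : Fin (2 * 3), canV 3 u j • gammaM 3 1 ((j : ℕ) + 1)).mulVec u = 0 ∧
    ∑ j : Fin (2 * 3), (if (j : ℕ) = 0 then -1 else 1) * (canV 3 u j) ^ 2 = 0 := by
  have h_111 : u ![1, 1, 1] = _ := apply_flip_of_mem_DeltaSp_three hu 0 0 0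
  have h_110 : u ![1, 1, 0] = _ := apply_flip_of_mem_DeltaSp_three hu 0 0 1
  have h_101 : u ![1, 0, 1] = _ := apply_flip_of_mem_DeltaSp_three hu 0 1 0
  have h_100 : u ![1, 0, 0] = _ := apply_flip_of_mem_DeltaSp_three hu 0 1 1
  have hε2 : (ε : ℂ) ^ 2 = 1 := by rcases hε with rfl | rfl <;> simp
  have hε3 : (ε : ℂ) ^ 3 = ε := by rw [pow_succ, hε2, one_mul]
  have hε4 : (ε : ℂ) ^ 4 = 1 := by rw [pow_succ, hε3, ← sq, hε2]
  have hI5 : I ^ 5 = I := by simp [pow_succ]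
  have hI6 : I ^ 6 = -1 := by simp [pow_succ]
  rw [canV_three]
  constructor
  · refine funext (forall_fin_three_arrow.mpr ?_)
    intro a b c
    simp only [Fin.sum_univ_succ (n := 5), Fin.sum_univ_five, Matrix.add_mulVec,
      Matrix.smul_mulVec, Pi.add_apply, Pi.smul_apply]
    simp [gammaM_three_one_mulVec, gammaM_three_two_mulVec, gammaM_three_three_mulVec,
      gammaM_three_four_mulVec, gammaM_three_five_mulVec, gammaM_three_six_mulVec]
    fin_cases a <;> fin_cases b <;> fin_cases c <;>
      simp [h_111, h_110, h_101, h_100] <;> ring_nf <;>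
      simp [hε2, hε3, hI5] <;> ring
  · rw [Fin.sum_univ_succ (n := 5), Fin.sum_univ_five]
    simp [h_111, h_110, h_101, h_100]
    ring_nf
    simp [hε2, hε4, hI6]
    ring

/-- for `m ∈ {1,2,3}` and `k = 1`, every half spinor `u ∈ Δ^ε_{2m,1}`
satisfies `γ(V_u) · u = 0`; in particular its canonical vector `V_u` is isotropic:
`-(V_u)₁² + Σ_{j≥2} (V_u)_j² = 0`. -/
theorem half_spinor_canonical_vector_isotropic (m : ℕ) (hm : m = 1 ∨ m = 2 ∨ m = 3)
    (ε : ℤ) (hε : ε = 1 ∨ ε = -1) (u : (Fin m → Fin 2) → ℂ) (hu : u ∈ DeltaSp m 1 ε) :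
    (∑ j : Fin (2 * m), canV m u j • gammaM m 1 ((j : ℕ) + 1)).mulVec u = 0 ∧
    ∑ j : Fin (2 * m), (if (j : ℕ) = 0 then -1 else 1) * (canV m u j) ^ 2 = 0 := by
  rcases hm with rfl | rfl | rfl
  · exact canV_isotropic_one hε hu
  · exact canV_isotropic_two hε hu
  · exact canV_isotropic_three hε hu
end

section
/- Let m = 2 and k = 1. For every sign ε = ±1 and complex numbers a, b, the spinor u := a·u(ε,1) + b·u(−ε,−1) lies in Δ^ε_{4,1} and its canonical vector is V_u = ( |a|² + |b|², |a|² − |b|², −2 Re(i a b̄), −2 ε Re(a b̄) ) ∈ ℝ⁴. -/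
open Matrix Complex

/-- Iterated Kronecker products act factorwise on product vectors. -/
theorem gammaM_mulVec_prod (m k l : ℕ) (v : Fin m → Fin 2 → ℂ) :
    (gammaM m k l).mulVec (fun i => ∏ α, v α (i α)) =
      tauC k l • fun i => ∏ α, (gammaFac m l α).mulVec (v α) (i α) := by
  ext i
  simp only [Matrix.mulVec, dotProduct, gammaM, Matrix.of_apply, Pi.smul_apply, smul_eq_mul,
    Fintype.prod_sum, Finset.mul_sum, Finset.prod_mul_distrib, mul_assoc]

/-- The Hermitian product of product vectors is the product of the Hermitian products. -/
theorem hermIP_prod (m : ℕ) (v w : Fin m → Fin 2 → ℂ) :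
    hermIP (fun i : Fin m → Fin 2 => ∏ α, v α (i α)) (fun i => ∏ α, w α (i α)) =
      ∏ α, hermIP (v α) (w α) := by
  simp only [hermIP, Fintype.prod_sum, map_prod, Finset.prod_mul_distrib]

theorem matE_mulVec (v : Fin 2 → ℂ) : matE.mulVec v = v := by
  rw [matE, ← Matrix.one_fin_two, Matrix.one_mulVec]

theorem matU_mulVec_uVec (δ : ℤ) : matU.mulVec (uVec δ) = Complex.I • uVec (-δ) := by
  ext t
  fin_cases t <;> simp [matU, uVec, Matrix.mulVec, dotProduct]

theorem matV_mulVec_uVec {δ : ℤ} (hδ : δ = 1 ∨ δ = -1) :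
    matV.mulVec (uVec δ) = (δ : ℂ) • uVec (-δ) := by
  ext t
  rcases hδ with rfl | rfl <;> fin_cases t <;>
    simp [matV, uVec, Matrix.mulVec, dotProduct, ← mul_assoc]

theorem matT_mulVec_uVec {δ : ℤ} (hδ : δ = 1 ∨ δ = -1) :
    matT.mulVec (uVec δ) = (-δ : ℂ) • uVec δ := by
  ext t
  rcases hδ with rfl | rfl <;> fin_cases t <;>
    simp [matT, uVec, Matrix.mulVec, dotProduct, ← mul_assoc]

theorem hermIP_uVec_self {δ : ℤ} (hδ : δ = 1 ∨ δ = -1) : hermIP (uVec δ) (uVec δ) = 1 := by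
  have h : (Real.sqrt 2 : ℂ)⁻¹ * (Real.sqrt 2 : ℂ)⁻¹ = 2⁻¹ := by
    rw [← mul_inv, ← Complex.ofReal_mul, Real.mul_self_sqrt zero_le_two, Complex.ofReal_ofNat]
  rcases hδ with rfl | rfl <;> simp [hermIP, uVec] <;>
    linear_combination (1 - Complex.I ^ 2) * h - 2⁻¹ * Complex.I_sq

theorem hermIP_uVec_neg {δ : ℤ} (hδ : δ = 1 ∨ δ = -1) : hermIP (uVec δ) (uVec (-δ)) = 0 := by
  rcases hδ with rfl | rfl <;> simp [hermIP, uVec] <;>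
    linear_combination (Real.sqrt 2 : ℂ)⁻¹ ^ 2 * Complex.I_sq

/-- The product spinor `u(d,e)`. -/
noncomputable def uTwo (d e : ℤ) : (Fin 2 → Fin 2) → ℂ := fun i => uVec d (i 0) * uVec e (i 1)

theorem uProd_two (d e : ℤ) : uProd 2 ![d, e] = uTwo d e := by
  ext i
  simp [uProd, uTwo, Fin.prod_univ_two]

/-- If the two factors of `γ_l` act on `u(d)` and `u(e)` by scalars up to sign changes,
so does `γ_l` on `u(d,e)`. -/
theorem gammaM_mulVec_uTwo {l : ℕ} {A B : Matrix (Fin 2) (Fin 2) ℂ} {d e d' e' : ℤ} {x y : ℂ}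
    (hA : gammaFac 2 l 0 = A) (hB : gammaFac 2 l 1 = B)
    (hd : A.mulVec (uVec d) = x • uVec d') (he : B.mulVec (uVec e) = y • uVec e') :
    (gammaM 2 1 l).mulVec (uTwo d e) = (tauC 1 l * x * y) • uTwo d' e' := by
  have h := gammaM_mulVec_prod 2 1 l ![uVec d, uVec e]
  simp only [Fin.prod_univ_two, Matrix.cons_val_zero, Matrix.cons_val_one, hA, hB, hd, he] at h
  refine h.trans ?_
  ext i
  simp only [Pi.smul_apply, smul_eq_mul, uTwo]
  ring

theorem gammaM_one_mulVec_uTwo (d e : ℤ) :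
    (gammaM 2 1 1).mulVec (uTwo d e) = (-1 : ℂ) • uTwo d (-e) := by
  rw [gammaM_mulVec_uTwo (by simp [gammaFac]) (by simp [gammaFac])
    ((matE_mulVec _).trans (one_smul ℂ _).symm) (matU_mulVec_uVec e)]
  simp [tauC]

theorem gammaM_two_mulVec_uTwo (d : ℤ) {e : ℤ} (he : e = 1 ∨ e = -1) :
    (gammaM 2 1 2).mulVec (uTwo d e) = (e : ℂ) • uTwo d (-e) := by
  rw [gammaM_mulVec_uTwo (by simp [gammaFac]) (by simp [gammaFac])
    ((matE_mulVec _).trans (one_smul ℂ _).symm) (matV_mulVec_uVec he)]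
  simp [tauC]

theorem gammaM_three_mulVec_uTwo (d : ℤ) {e : ℤ} (he : e = 1 ∨ e = -1) :
    (gammaM 2 1 3).mulVec (uTwo d e) = (-e * Complex.I : ℂ) • uTwo (-d) e := by
  rw [gammaM_mulVec_uTwo (by simp [gammaFac]) (by simp [gammaFac])
    (matU_mulVec_uVec d) (matT_mulVec_uVec he)]
  simp [tauC, mul_comm]

theorem gammaM_four_mulVec_uTwo {d e : ℤ} (hd : d = 1 ∨ d = -1) (he : e = 1 ∨ e = -1) :
    (gammaM 2 1 4).mulVec (uTwo d e) = (-d * e : ℂ) • uTwo (-d) e := by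
  rw [gammaM_mulVec_uTwo (by simp [gammaFac]) (by simp [gammaFac])
    (matV_mulVec_uVec hd) (matT_mulVec_uVec he)]
  simp [tauC]

theorem hermIP_uTwo (d e d' e' : ℤ) :
    hermIP (uTwo d e) (uTwo d' e') = hermIP (uVec d) (uVec d') * hermIP (uVec e) (uVec e') := by
  have h := hermIP_prod 2 ![uVec d, uVec e] ![uVec d', uVec e']
  simp only [Fin.prod_univ_two, Matrix.cons_val_zero, Matrix.cons_val_one] at h
  exact h

theorem hermIP_add_left {ι : Type*} [Fintype ι] (x y z : ι → ℂ) :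
    hermIP (x + y) z = hermIP x z + hermIP y z := by
  simp [hermIP, add_mul, Finset.sum_add_distrib]

theorem hermIP_add_right {ι : Type*} [Fintype ι] (x y z : ι → ℂ) :
    hermIP x (y + z) = hermIP x y + hermIP x z := by
  simp [hermIP, mul_add, Finset.sum_add_distrib]

theorem hermIP_smul_left {ι : Type*} [Fintype ι] (c : ℂ) (x y : ι → ℂ) :
    hermIP (c • x) y = c * hermIP x y := by
  simp [hermIP, Finset.mul_sum, mul_assoc]

theorem hermIP_smul_right {ι : Type*} [Fintype ι] (c : ℂ) (x y : ι → ℂ) :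
    hermIP x (c • y) = (starRingEnd ℂ) c * hermIP x y := by
  simp [hermIP, Finset.mul_sum, mul_left_comm]

theorem uTwo_mem_DeltaSp {d e : ℤ} (hd : d = 1 ∨ d = -1) (he : e = 1 ∨ e = -1) :
    uTwo d e ∈ DeltaSp 2 1 (d * e) := by
  have hvol : gammaVol 2 1 = gammaM 2 1 1 * (gammaM 2 1 2 * (gammaM 2 1 3 * gammaM 2 1 4)) := by
    simp [gammaVol, List.range_succ]
  rw [DeltaSp, Module.End.mem_eigenspace_iff, Matrix.toLin'_apply, hvol]
  simp only [← Matrix.mulVec_mulVec, Matrix.mulVec_smul, gammaM_four_mulVec_uTwo hd he,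
    gammaM_three_mulVec_uTwo (-d) he, gammaM_two_mulVec_uTwo _ he, gammaM_one_mulVec_uTwo,
    smul_smul, neg_neg]
  congr 1
  rcases hd with rfl | rfl <;> rcases he with rfl | rfl <;> simp [pow_succ]

/-- for `m = 2`, `k = 1`, every sign `ε` and `a, b ∈ ℂ`, the spinor
`u = a·u(ε,1) + b·u(-ε,-1)` lies in `Δ^ε_{4,1}` and its canonical vector is
`V_u = (|a|² + |b|², |a|² - |b|², -2 Re(i a b̄), -2 ε Re(a b̄))`. -/
theorem canonical_vector_of_half_spinor_dim4 (ε : ℤ) (hε : ε = 1 ∨ ε = -1) (a b : ℂ)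
    (u : (Fin 2 → Fin 2) → ℂ)
    (hu : u = a • uProd 2 ![ε, 1] + b • uProd 2 ![-ε, -1]) :
    u ∈ DeltaSp 2 1 ε ∧
    canV 2 u 0 = ((‖a‖ ^ 2 + ‖b‖ ^ 2 : ℝ) : ℂ) ∧
    canV 2 u 1 = ((‖a‖ ^ 2 - ‖b‖ ^ 2 : ℝ) : ℂ) ∧
    canV 2 u 2 = ((-2 * (Complex.I * a * (starRingEnd ℂ) b).re : ℝ) : ℂ) ∧
    canV 2 u 3 = ((-2 * (ε : ℝ) * (a * (starRingEnd ℂ) b).re : ℝ) : ℂ) := by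
  have h1 : (1 : ℤ) = 1 ∨ (1 : ℤ) = -1 := Or.inl rfl
  have h2 : (-1 : ℤ) = 1 ∨ (-1 : ℤ) = -1 := Or.inr rfl
  have hε' : -ε = 1 ∨ -ε = -1 := by omega
  rw [uProd_two, uProd_two] at hu
  have hna := Complex.mul_conj' a
  have hnb := Complex.mul_conj' b
  have e1 := hermIP_uVec_self h1
  have e2 := hermIP_uVec_self h2
  have e3 := hermIP_uVec_neg h1
  have e4 := hermIP_uVec_neg h2
  have f1 := hermIP_uVec_self hε
  have f2 := hermIP_uVec_self hε'
  have f3 := hermIP_uVec_neg hε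
  have f4 := hermIP_uVec_neg hε'
  rw [neg_neg] at e4 f4
  have hre := Complex.re_eq_add_conj (a * (starRingEnd ℂ) b)
  have him := Complex.re_eq_add_conj (Complex.I * a * (starRingEnd ℂ) b)
  simp only [map_mul, Complex.conj_conj, Complex.conj_I] at hre him
  subst hu
  refine ⟨Submodule.add_mem _ (Submodule.smul_mem _ _ ?_) (Submodule.smul_mem _ _ ?_), ?_⟩
  · simpa using uTwo_mem_DeltaSp hε h1
  · simpa using uTwo_mem_DeltaSp hε' h2
  have v0 : ((0 : Fin (2 * 2)) : ℕ) + 1 = 1 := rfl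
  have v1 : ((1 : Fin (2 * 2)) : ℕ) + 1 = 2 := rfl
  have v2 : ((2 : Fin (2 * 2)) : ℕ) + 1 = 3 := rfl
  have v3 : ((3 : Fin (2 * 2)) : ℕ) + 1 = 4 := rfl
  have s1 : epsC 1 1 = -1 := by simp [epsC]
  have s2 : epsC 1 2 = 1 := by simp [epsC]
  have s3 : epsC 1 3 = 1 := by simp [epsC]
  have s4 : epsC 1 4 = 1 := by simp [epsC]
  push_cast [hre, him, ← hna, ← hnb]
  simp only [canV, indefIP, v0, v1, v2, v3, s1, s2, s3, s4, Matrix.mulVec_add, Matrix.mulVec_smul,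
    gammaM_one_mulVec_uTwo,
    gammaM_two_mulVec_uTwo _ h1, gammaM_two_mulVec_uTwo _ h2,
    gammaM_three_mulVec_uTwo _ h1, gammaM_three_mulVec_uTwo _ h2,
    gammaM_four_mulVec_uTwo hε h1, gammaM_four_mulVec_uTwo hε' h2, neg_neg,
    hermIP_add_left, hermIP_add_right, hermIP_smul_left, hermIP_smul_right, hermIP_uTwo,
    e1, e2, e3, e4, f1, f2, f3, f4]
  push_cast
  refine ⟨?_, ?_, ?_, ?_⟩ <;> ring
end

section
/- Let m = 2 and k = 1. Let W : {1,2,3,4}⁴ → ℝ be antisymmetric in its first two arguments (W_{rljk} = −W_{lrjk}). Let ε = ±1, a, b ∈ ℂ, u := a·u(ε,1) + b·u(−ε,−1), and let V_u ∈ ℝ⁴ be the canonical vector of u. If for all j, k ∈ {1,2,3,4} one has Σ_{1 ≤ r < l ≤ 4} ε_r ε_l W_{rljk} · γ_r γ_l u = 0, then Σ_{s=1}^{4} (V_u)_s · W_{sijk} = 0 for all i, j, k ∈ {1,2,3,4}. -/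
open Matrix Complex

/-- The spinor in `ℂ² ⊗ ℂ²` with coordinates `a, b, c, d` in the standard basis. -/
def spinor (a b c d : ℂ) : (Fin 2 → Fin 2) → ℂ := fun i => !![a, b; c, d] (i 0) (i 1)

theorem spinor_eta (u : (Fin 2 → Fin 2) → ℂ) :
    spinor (u ![0, 0]) (u ![0, 1]) (u ![1, 0]) (u ![1, 1]) = u := by
  funext i
  obtain ⟨⟨p, q⟩, rfl⟩ := (finTwoArrowEquiv (Fin 2)).symm.surjective i
  fin_cases p <;> fin_cases q <;> rfl

theorem spinor_ext {u v : (Fin 2 → Fin 2) → ℂ} (h : ∀ p q, u ![p, q] = v ![p, q]) : u = v := by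
  rw [← spinor_eta u, ← spinor_eta v]
  simp only [h]

theorem sum_fin_two_arrow_s8 (f : (Fin 2 → Fin 2) → ℂ) :
    ∑ i, f i = f ![0, 0] + f ![0, 1] + (f ![1, 0] + f ![1, 1]) := by
  rw [← (finTwoArrowEquiv (Fin 2)).symm.sum_comp, Fintype.sum_prod_type]
  simp [Fin.sum_univ_two, finTwoArrowEquiv]

theorem spinor_add (a b c d a' b' c' d' : ℂ) :
    spinor a b c d + spinor a' b' c' d' = spinor (a + a') (b + b') (c + c') (d + d') :=
  spinor_ext fun p q => by fin_cases p <;> fin_cases q <;> rfl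

theorem smul_spinor (t a b c d : ℂ) :
    t • spinor a b c d = spinor (t * a) (t * b) (t * c) (t * d) :=
  spinor_ext fun p q => by fin_cases p <;> fin_cases q <;> rfl

theorem hermIP_spinor (a b c d a' b' c' d' : ℂ) :
    hermIP (spinor a b c d) (spinor a' b' c' d') =
      a * starRingEnd ℂ a' + b * starRingEnd ℂ b' +
        (c * starRingEnd ℂ c' + d * starRingEnd ℂ d') := by
  simp [hermIP, sum_fin_two_arrow_s8, spinor]

theorem gammaM_one_mulVec_s8 (a b c d : ℂ) :
    gammaM 2 1 1 *ᵥ spinor a b c d = spinor (-a) b (-c) d :=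
  spinor_ext fun p q => by
    fin_cases p <;> fin_cases q <;>
      simp [mulVec, dotProduct, sum_fin_two_arrow_s8, gammaM, gammaFac, tauC, matE, matU, spinor,
        ← mul_assoc]

theorem gammaM_two_mulVec_s8 (a b c d : ℂ) :
    gammaM 2 1 2 *ᵥ spinor a b c d = spinor (I * b) (I * a) (I * d) (I * c) :=
  spinor_ext fun p q => by
    fin_cases p <;> fin_cases q <;>
      simp [mulVec, dotProduct, sum_fin_two_arrow_s8, gammaM, gammaFac, tauC, matE, matV, spinor]

theorem gammaM_three_mulVec_s8 (a b c d : ℂ) :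
    gammaM 2 1 3 *ᵥ spinor a b c d = spinor b (-a) (-d) c :=
  spinor_ext fun p q => by
    fin_cases p <;> fin_cases q <;>
      simp [mulVec, dotProduct, sum_fin_two_arrow_s8, gammaM, gammaFac, tauC, matU, matT, spinor]

theorem gammaM_four_mulVec (a b c d : ℂ) :
    gammaM 2 1 4 *ᵥ spinor a b c d = spinor d (-c) b (-a) :=
  spinor_ext fun p q => by
    fin_cases p <;> fin_cases q <;>
      simp [mulVec, dotProduct, sum_fin_two_arrow_s8, gammaM, gammaFac, tauC, matV, matT, spinor]

/-- The Clifford action `Σ_{r<l} ε_r ε_l w_{rl} γ_r γ_l u` of a 2-form `w` on a spinor `u`. -/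
def twoFormAct (w : Fin 4 → Fin 4 → ℝ) (u : (Fin 2 → Fin 2) → ℂ) : (Fin 2 → Fin 2) → ℂ :=
  ∑ r : Fin 4, ∑ l : Fin 4,
    (if r < l then
      ((epsC 1 ((r : ℕ) + 1) * epsC 1 ((l : ℕ) + 1) * (w r l : ℂ)) •
        ((gammaM 2 1 ((r : ℕ) + 1) * gammaM 2 1 ((l : ℕ) + 1)).mulVec u))
      else 0)

theorem twoFormAct_eq (w : Fin 4 → Fin 4 → ℝ) (u : (Fin 2 → Fin 2) → ℂ) :
    twoFormAct w u =
      (-(w 0 1 : ℂ)) • gammaM 2 1 1 *ᵥ gammaM 2 1 2 *ᵥ u +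
      (-(w 0 2 : ℂ)) • gammaM 2 1 1 *ᵥ gammaM 2 1 3 *ᵥ u +
      (-(w 0 3 : ℂ)) • gammaM 2 1 1 *ᵥ gammaM 2 1 4 *ᵥ u +
      (w 1 2 : ℂ) • gammaM 2 1 2 *ᵥ gammaM 2 1 3 *ᵥ u +
      (w 1 3 : ℂ) • gammaM 2 1 2 *ᵥ gammaM 2 1 4 *ᵥ u +
      (w 2 3 : ℂ) • gammaM 2 1 3 *ᵥ gammaM 2 1 4 *ᵥ u := by
  simp [twoFormAct, Fin.sum_univ_four, epsC, add_assoc]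

/-- Contracting the canonical vector with a 2-form `w` measures the failure of `w` to annihilate
the spinor: this is the commutator `[w, γ_i] = -2 Σ_r ε_r w_{ri} γ_r` paired with the spinor. -/
theorem two_mul_sum_canV_mul (w : Fin 4 → Fin 4 → ℝ) (hw : ∀ r l, w r l = -w l r)
    (u : (Fin 2 → Fin 2) → ℂ) (i : Fin 4) :
    2 * ∑ s : Fin 4, canV 2 u s * (w s i : ℂ) =
      -(indefIP 2 (gammaM 2 1 ((i : ℕ) + 1) *ᵥ u) (twoFormAct w u) +
        indefIP 2 (gammaM 2 1 ((i : ℕ) + 1) *ᵥ twoFormAct w u) u) := by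
  have hdiag (r : Fin 4) : w r r = 0 := by linarith [hw r r]
  have h10 := hw 1 0
  have h20 := hw 2 0
  have h30 := hw 3 0
  have h21 := hw 2 1
  have h31 := hw 3 1
  have h32 := hw 3 2
  rw [twoFormAct_eq, ← spinor_eta u]
  fin_cases i <;>
    (simp [Fin.sum_univ_four, canV, indefIP, epsC, gammaM_one_mulVec_s8, gammaM_two_mulVec_s8,
      gammaM_three_mulVec_s8, gammaM_four_mulVec, smul_spinor, spinor_add, hermIP_spinor,
      h10, h20, h30, h21, h31, h32, hdiag, -mulVec_mulVec, -neg_smul, -Complex.coe_smul]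
     ring_nf <;> simp only [I_sq] <;> ring)

/-- for `m = 2`, `k = 1`, let `W` be antisymmetric in its first two
arguments, `u = a·u(ε,1) + b·u(-ε,-1)`.  If `Σ_{r<l} ε_r ε_l W_{rljk} γ_r γ_l u = 0`
for all `j, k`, then `Σ_s (V_u)_s W_{sijk} = 0` for all `i, j, k`. -/
theorem weyl_contraction_vanishes (W : Fin 4 → Fin 4 → Fin 4 → Fin 4 → ℝ)
    (hW : ∀ r l j k : Fin 4, W r l j k = -W l r j k)
    (ε : ℤ) (hε : ε = 1 ∨ ε = -1) (a b : ℂ) (u : (Fin 2 → Fin 2) → ℂ)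
    (hu : u = a • uProd 2 ![ε, 1] + b • uProd 2 ![-ε, -1])
    (h : ∀ j k : Fin 4,
      ∑ r : Fin 4, ∑ l : Fin 4,
        (if r < l then
          ((epsC 1 ((r : ℕ) + 1) * epsC 1 ((l : ℕ) + 1) * (W r l j k : ℂ)) •
            ((gammaM 2 1 ((r : ℕ) + 1) * gammaM 2 1 ((l : ℕ) + 1)).mulVec u))
         else 0) = 0) :
    ∀ i j k : Fin 4, ∑ s : Fin 4, canV 2 u s * (W s i j k : ℂ) = 0 := by
  intro i j k
  have hact : twoFormAct (fun r l => W r l j k) u = 0 := h j k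
  have key := two_mul_sum_canV_mul (fun r l => W r l j k) (fun r l => hW r l j k) u i
  simpa [hact, indefIP, hermIP] using key
end

section
/- Define the indefinite inner product ⟨w, ŵ⟩ := (γ_1 w, ŵ) on ℂ^{2^{n+1}}, where (·,·) is the standard Hermitian inner product (conjugate-linear in the second argument). Then for all x, y, x̂, ŷ ∈ ℂ^{2^n}: ⟨ x ⊗ u(1) + y ⊗ u(−1), x̂ ⊗ u(1) + ŷ ⊗ u(−1) ⟩ = −(y, x̂) − (x, ŷ), where (·,·) on the right-hand side is the standard Hermitian inner product on ℂ^{2^n}. -/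
open Matrix Complex

/-- `γ_1 = i · (E ⊗ ⋯ ⊗ E ⊗ U)`, entrywise. -/
theorem gammaM_one_one_apply (n : ℕ) (i i' : Fin (n + 1) → Fin 2) :
    gammaM (n + 1) 1 1 i i' =
      Complex.I * ((if Fin.init i = Fin.init i' then 1 else 0) *
        matU (i (Fin.last n)) (i' (Fin.last n))) := by
  have hE (α : Fin n) : gammaFac (n + 1) 1 α.castSucc = 1 := by
    simp [gammaFac, matE_eq_one]
  have hU : gammaFac (n + 1) 1 (Fin.last n) = matU := by simp [gammaFac]
  have hprod : ∏ α : Fin n, (1 : Matrix (Fin 2) (Fin 2) ℂ) (i α.castSucc) (i' α.castSucc) =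
      if Fin.init i = Fin.init i' then 1 else 0 := by
    simp only [Matrix.one_apply, Finset.prod_ite_zero, Finset.prod_const_one, Finset.mem_univ,
      true_imp_iff, funext_iff, Fin.init]
  simp only [gammaM, Matrix.of_apply, tauC, le_refl, if_true, Fin.prod_univ_castSucc, hE, hU, hprod]

theorem sum_snoc {n : ℕ} (f : (Fin (n + 1) → Fin 2) → ℂ) :
    ∑ i, f i = ∑ j : Fin n → Fin 2, ∑ t : Fin 2, f (Fin.snoc (α := fun _ => Fin 2) j t) := by
  rw [← (Fin.snocEquiv fun _ => Fin 2).sum_comp, Fintype.sum_prod_type_right]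
  rfl

theorem tensP_snoc (n : ℕ) (x : (Fin n → Fin 2) → ℂ) (v : Fin 2 → ℂ) (j : Fin n → Fin 2)
    (t : Fin 2) : tensP n x v (Fin.snoc (α := fun _ => Fin 2) j t) = x j * v t := by
  simp [tensP]

/-- `γ_1` acts on `x ⊗ v` through the last factor. -/
theorem gammaM_one_one_mulVec_tensP (n : ℕ) (x : (Fin n → Fin 2) → ℂ) (v : Fin 2 → ℂ) :
    (gammaM (n + 1) 1 1).mulVec (tensP n x v) = tensP n x (Complex.I • matU.mulVec v) := by
  ext i
  simp only [Matrix.mulVec, dotProduct, sum_snoc, gammaM_one_one_apply, tensP_snoc,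
    Fin.init_snoc, Fin.snoc_last]
  rw [Finset.sum_eq_single (Fin.init i) (fun j _ hj => by simp [hj.symm]) (by simp)]
  simp only [tensP, Pi.smul_apply, smul_eq_mul, Matrix.mulVec, dotProduct, if_true,
    Fin.sum_univ_two]
  ring

theorem I_smul_matU_mulVec_uVec (δ : ℤ) :
    Complex.I • matU.mulVec (uVec δ) = -uVec (-δ) := by
  ext t
  fin_cases t <;>
    simp [matU, uVec, dotProduct, Fin.sum_univ_two, ← mul_assoc]

theorem hermIP_neg_left {ι : Type*} [Fintype ι] (x y : ι → ℂ) :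
    hermIP (-x) y = -hermIP x y := by
  simp [hermIP]

theorem hermIP_tensP (n : ℕ) (x y : (Fin n → Fin 2) → ℂ) (v w : Fin 2 → ℂ) :
    hermIP (tensP n x v) (tensP n y w) = hermIP x y * hermIP v w := by
  simp only [hermIP, sum_snoc, tensP_snoc, Finset.sum_mul_sum, map_mul]
  exact Finset.sum_congr rfl fun _ _ => Finset.sum_congr rfl fun _ _ => by ring

theorem hermIP_uVec (δ ε : ℤ) : hermIP (uVec δ) (uVec ε) = (1 + δ * ε) / 2 := by
  have h : ((Real.sqrt 2 : ℂ)⁻¹) * (Real.sqrt 2 : ℂ)⁻¹ = 1 / 2 := by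
    rw [← mul_inv, ← Complex.ofReal_mul, Real.mul_self_sqrt (by norm_num)]
    norm_num
  simp only [hermIP, uVec, Fin.sum_univ_two, if_true, one_ne_zero, if_false, map_mul, map_neg,
    map_inv₀, Complex.conj_ofReal, Complex.conj_I, map_intCast]
  linear_combination (1 - δ * ε * Complex.I ^ 2) * h - δ * ε / 2 * Complex.I_sq

/-- for the indefinite inner product `⟨w,ŵ⟩ = (γ_1 w, ŵ)` on `ℂ^{2^{n+1}}`,
`⟨x ⊗ u(1) + y ⊗ u(-1), x̂ ⊗ u(1) + ŷ ⊗ u(-1)⟩ = -(y, x̂) - (x, ŷ)`. -/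
theorem indefIP_on_split_spinors (n : ℕ) (hn : 1 ≤ n)
    (x y x' y' : (Fin n → Fin 2) → ℂ) :
    hermIP ((gammaM (n + 1) 1 1).mulVec (tensP n x (uVec 1) + tensP n y (uVec (-1))))
        (tensP n x' (uVec 1) + tensP n y' (uVec (-1))) =
      -hermIP y x' - hermIP x y' := by
  simp only [Matrix.mulVec_add, gammaM_one_one_mulVec_tensP, I_smul_matU_mulVec_uVec,
    hermIP_add_left, hermIP_add_right, hermIP_tensP, hermIP_neg_left, hermIP_uVec]
  push_cast
  ring
end
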